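/- For all integers a, b ≥ 0 and every integer i with 0 ≤ i ≤ a, the pair (F₁, F₂) given by F₁ = Σ_{k=0}^{min(a−i−1,b)} (−1)^{b−k} z₂^{k+i+1} w₂^k z₁^{a−i−k−1} w₁^{b−k} / ((k+i+1)!·k!·(a−i−k−1)!·(b−k)!) and F₂ = Σ_{k=0}^{min(a−i,b)} (−1)^{b−k} z₂^{k+i} w₂^k z₁^{a−i−k} w₁^{b−k} / ((k+i)!·k!·(a−i−k)!·(b−k)!) satisfies the Hermitean monogenicity system ∂_{z₁}F₂ − ∂_{z₂}F₁ = 0 and ∂_{w₁}F₁ + ∂_{w₂}F₂ = 0. -/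

import Mathlib

open MvPolynomial

noncomputable section

/-- The polynomial ring `ℂ[z₁, z₂, w₁, w₂]`, with `X 0 = z₁`, `X 1 = z₂`,
`X 2 = w₁`, `X 3 = w₂` (where `w₁, w₂` play the role of `z̄₁, z̄₂`). -/
abbrev CPoly : Type := MvPolynomial (Fin 4) ℂ

def z1 : CPoly := X 0
def z2 : CPoly := X 1
def w1 : CPoly := X 2
def w2 : CPoly := X 3

/-- The pair `(F₁, F₂)` of formula (10) of the paper (initial data `A_{a,b-j}`):
`F₁ = Σ_{k=0}^{min(a,b−j)} (−1)^{b−j−k} z₂^k w₂^{k+j} z₁^{a−k} w₁^{b−j−k} /(k!(k+j)!(a−k)!(b−j−k)!)`,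
`F₂ = Σ_{k=0}^{min(a,b−j−1)} (−1)^{b−j−k−1} z₂^k w₂^{k+j+1} z₁^{a−k} w₁^{b−j−k−1} /(k!(k+j+1)!(a−k)!(b−j−k−1)!)`,
empty sums being `0`.  (Note `Finset.range (min (a+1) (b-j+1))` is `{0,…,min a (b−j)}`
and `Finset.range (min (a+1) (b-j))` is `{0,…,min a (b−j−1)}`, empty when `j = b`.) -/
def PA (a b j : ℕ) : CPoly × CPoly :=
  (∑ k ∈ Finset.range (min (a + 1) (b - j + 1)),
      C ((-1 : ℂ) ^ (b - j - k) /
          ((k.factorial : ℂ) * ((k + j).factorial : ℂ) * ((a - k).factorial : ℂ) *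
            ((b - j - k).factorial : ℂ)))
        * z2 ^ k * w2 ^ (k + j) * z1 ^ (a - k) * w1 ^ (b - j - k),
   ∑ k ∈ Finset.range (min (a + 1) (b - j)),
      C ((-1 : ℂ) ^ (b - j - k - 1) /
          ((k.factorial : ℂ) * ((k + j + 1).factorial : ℂ) * ((a - k).factorial : ℂ) *
            ((b - j - k - 1).factorial : ℂ)))
        * z2 ^ k * w2 ^ (k + j + 1) * z1 ^ (a - k) * w1 ^ (b - j - k - 1))

/-- The pair `(F₁, F₂)` of formula (11) of the paper (initial data `B_{a-i,b}`):
`F₁ = Σ_{k=0}^{min(a−i−1,b)} (−1)^{b−k} z₂^{k+i+1} w₂^k z₁^{a−i−k−1} w₁^{b−k} /((k+i+1)!k!(a−i−k−1)!(b−k)!)`,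
`F₂ = Σ_{k=0}^{min(a−i,b)} (−1)^{b−k} z₂^{k+i} w₂^k z₁^{a−i−k} w₁^{b−k} /((k+i)!k!(a−i−k)!(b−k)!)`,
empty sums being `0`.  (Note `Finset.range (min (a-i) (b+1))` is `{0,…,min (a−i−1) b}`,
empty when `i = a`, and `Finset.range (min (a-i+1) (b+1))` is `{0,…,min (a−i) b}`.) -/
def PB (a b i : ℕ) : CPoly × CPoly :=
  (∑ k ∈ Finset.range (min (a - i) (b + 1)),
      C ((-1 : ℂ) ^ (b - k) /
          (((k + i + 1).factorial : ℂ) * (k.factorial : ℂ) * ((a - i - k - 1).factorial : ℂ) *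
            ((b - k).factorial : ℂ)))
        * z2 ^ (k + i + 1) * w2 ^ k * z1 ^ (a - i - k - 1) * w1 ^ (b - k),
   ∑ k ∈ Finset.range (min (a - i + 1) (b + 1)),
      C ((-1 : ℂ) ^ (b - k) /
          (((k + i).factorial : ℂ) * (k.factorial : ℂ) * ((a - i - k).factorial : ℂ) *
            ((b - k).factorial : ℂ)))
        * z2 ^ (k + i) * w2 ^ k * z1 ^ (a - i - k) * w1 ^ (b - k))

/-- The basis pair `P_{a,b,μ}`: for `a+1−b ≤ μ ≤ a+1` it is given by the formula (10)
with `j = μ − a − 1 + b`; for `−b ≤ μ ≤ a−b` by the formula (11) with `i = a − b − μ`;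
and it is `(0,0)` for `μ` outside `[−b, a+1]`. -/
def Ppair (a b : ℕ) (μ : ℤ) : CPoly × CPoly :=
  if (a : ℤ) + 1 - b ≤ μ ∧ μ ≤ (a : ℤ) + 1 then PA a b (μ - a - 1 + b).toNat
  else if -(b : ℤ) ≤ μ ∧ μ ≤ (a : ℤ) - b then PB a b ((a : ℤ) - b - μ).toNat
  else 0

/-- The monomial `s z₂^p w₂^q z₁^r w₁^t / (p! q! r! t!)`. -/
def dividedMonomial (s : ℂ) (p q r t : ℕ) : CPoly :=
  C (s / ((p.factorial : ℂ) * (q.factorial : ℂ) * (r.factorial : ℂ) * (t.factorial : ℂ)))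
    * z2 ^ p * w2 ^ q * z1 ^ r * w1 ^ t

lemma dividedMonomial_eq_monomial (s : ℂ) (p q r t : ℕ) :
    dividedMonomial s p q r t =
      monomial (Finsupp.single 1 p + Finsupp.single 3 q + Finsupp.single 0 r + Finsupp.single 2 t)
        (s / ((p.factorial : ℂ) * (q.factorial : ℂ) * (r.factorial : ℂ) *
          (t.factorial : ℂ))) := by
  simp only [dividedMonomial, z1, z2, w1, w2, C_apply, X_pow_eq_monomial, monomial_mul, mul_one,
    zero_add]

lemma pderiv_zero_dividedMonomial_zero (s : ℂ) (p q t : ℕ) :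
    pderiv (0 : Fin 4) (dividedMonomial s p q 0 t) = 0 := by
  simp [dividedMonomial_eq_monomial, pderiv_monomial]

lemma pderiv_two_dividedMonomial_zero (s : ℂ) (p q r : ℕ) :
    pderiv (2 : Fin 4) (dividedMonomial s p q r 0) = 0 := by
  simp [dividedMonomial_eq_monomial, pderiv_monomial]

lemma pderiv_three_dividedMonomial_zero (s : ℂ) (p r t : ℕ) :
    pderiv (3 : Fin 4) (dividedMonomial s p 0 r t) = 0 := by
  simp [dividedMonomial_eq_monomial, pderiv_monomial]

lemma pderiv_zero_dividedMonomial_succ (s : ℂ) (p q r t : ℕ) :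
    pderiv (0 : Fin 4) (dividedMonomial s p q (r + 1) t) = dividedMonomial s p q r t := by
  rw [dividedMonomial_eq_monomial, dividedMonomial_eq_monomial, pderiv_monomial]
  refine congrArg₂ (fun m c => monomial m c) ?_ ?_
  · refine Finsupp.ext fun j => ?_
    fin_cases j <;> simp
  · have h := fun n : ℕ => Nat.cast_ne_zero (R := ℂ).2 n.factorial_ne_zero
    have hn : ((r : ℂ) + 1) ≠ 0 := Nat.cast_add_one_ne_zero r
    simp only [Nat.factorial_succ]
    simp
    field_simp [h p, h q, h r, h t]

lemma pderiv_one_dividedMonomial_succ (s : ℂ) (p q r t : ℕ) :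
    pderiv (1 : Fin 4) (dividedMonomial s (p + 1) q r t) = dividedMonomial s p q r t := by
  rw [dividedMonomial_eq_monomial, dividedMonomial_eq_monomial, pderiv_monomial]
  refine congrArg₂ (fun m c => monomial m c) ?_ ?_
  · refine Finsupp.ext fun j => ?_
    fin_cases j <;> simp
  · have h := fun n : ℕ => Nat.cast_ne_zero (R := ℂ).2 n.factorial_ne_zero
    have hn : ((p : ℂ) + 1) ≠ 0 := Nat.cast_add_one_ne_zero p
    simp only [Nat.factorial_succ]
    simp
    field_simp [h p, h q, h r, h t]

lemma pderiv_two_dividedMonomial_succ (s : ℂ) (p q r t : ℕ) :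
    pderiv (2 : Fin 4) (dividedMonomial s p q r (t + 1)) = dividedMonomial s p q r t := by
  rw [dividedMonomial_eq_monomial, dividedMonomial_eq_monomial, pderiv_monomial]
  refine congrArg₂ (fun m c => monomial m c) ?_ ?_
  · refine Finsupp.ext fun j => ?_
    fin_cases j <;> simp
  · have h := fun n : ℕ => Nat.cast_ne_zero (R := ℂ).2 n.factorial_ne_zero
    have hn : ((t : ℂ) + 1) ≠ 0 := Nat.cast_add_one_ne_zero t
    simp only [Nat.factorial_succ]
    simp
    field_simp [h p, h q, h r, h t]

lemma pderiv_three_dividedMonomial_succ (s : ℂ) (p q r t : ℕ) :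
    pderiv (3 : Fin 4) (dividedMonomial s p (q + 1) r t) = dividedMonomial s p q r t := by
  rw [dividedMonomial_eq_monomial, dividedMonomial_eq_monomial, pderiv_monomial]
  refine congrArg₂ (fun m c => monomial m c) ?_ ?_
  · refine Finsupp.ext fun j => ?_
    fin_cases j <;> simp
  · have h := fun n : ℕ => Nat.cast_ne_zero (R := ℂ).2 n.factorial_ne_zero
    have hn : ((q : ℂ) + 1) ≠ 0 := Nat.cast_add_one_ne_zero q
    simp only [Nat.factorial_succ]
    simp
    field_simp [h p, h q, h r, h t]

lemma PB_fst (a b i : ℕ) :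
    (PB a b i).1 = ∑ k ∈ Finset.range (min (a - i) (b + 1)),
      dividedMonomial ((-1) ^ (b - k)) (k + i + 1) k (a - i - k - 1) (b - k) := rfl

lemma PB_snd (a b i : ℕ) :
    (PB a b i).2 = ∑ k ∈ Finset.range (min (a - i + 1) (b + 1)),
      dividedMonomial ((-1) ^ (b - k)) (k + i) k (a - i - k) (b - k) := rfl

lemma neg_dividedMonomial (s : ℂ) (p q r t : ℕ) :
    dividedMonomial (-s) p q r t = -dividedMonomial s p q r t := by
  simp only [dividedMonomial, neg_div, map_neg, neg_mul]

lemma pderiv_zero_PB_snd (a b i : ℕ) :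
    pderiv (0 : Fin 4) (PB a b i).2 = pderiv (1 : Fin 4) (PB a b i).1 := by
  rw [PB_fst, PB_snd]
  generalize a - i = n
  rw [map_sum, map_sum]
  have hterm : ∀ k ∈ Finset.range (min n (b + 1)),
      pderiv (0 : Fin 4) (dividedMonomial ((-1) ^ (b - k)) (k + i) k (n - k) (b - k)) =
      pderiv (1 : Fin 4)
        (dividedMonomial ((-1) ^ (b - k)) (k + i + 1) k (n - k - 1) (b - k)) := by
    intro k hk
    obtain ⟨m, rfl⟩ : ∃ m, n = k + m + 1 := by
      have := Finset.mem_range.1 hk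
      exact ⟨n - k - 1, by omega⟩
    rw [pderiv_one_dividedMonomial_succ, show k + m + 1 - k = m + 1 by omega,
      pderiv_zero_dividedMonomial_succ, Nat.add_sub_cancel]
  rw [← Finset.sum_congr rfl hterm]
  rcases Nat.lt_or_ge b n with h | h
  · rw [min_eq_right (by omega), min_eq_right (by omega)]
  · rw [min_eq_left (by omega), min_eq_left (by omega), Finset.sum_range_succ, Nat.sub_self,
      pderiv_zero_dividedMonomial_zero, add_zero]

lemma pderiv_three_PB_snd (a b i : ℕ) :
    pderiv (3 : Fin 4) (PB a b i).2 = -pderiv (2 : Fin 4) (PB a b i).1 := by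
  rw [PB_fst, PB_snd]
  generalize a - i = n
  rw [map_sum, map_sum, ← Finset.sum_neg_distrib, Nat.add_min_add_right, Finset.sum_range_succ',
    pderiv_three_dividedMonomial_zero, add_zero]
  have hterm : ∀ k ∈ Finset.range (min n b),
      pderiv (3 : Fin 4) (dividedMonomial ((-1) ^ (b - (k + 1))) (k + 1 + i) (k + 1)
        (n - (k + 1)) (b - (k + 1))) =
      -pderiv (2 : Fin 4)
        (dividedMonomial ((-1) ^ (b - k)) (k + i + 1) k (n - k - 1) (b - k)) := by
    intro k hk
    obtain ⟨m, rfl⟩ : ∃ m, b = k + m + 1 := by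
      have := Finset.mem_range.1 hk
      exact ⟨b - k - 1, by omega⟩
    rw [show k + m + 1 - (k + 1) = m by omega, show k + m + 1 - k = m + 1 by omega,
      pderiv_three_dividedMonomial_succ, pderiv_two_dividedMonomial_succ, pow_succ, mul_neg_one,
      neg_dividedMonomial, neg_neg, add_right_comm, Nat.sub_sub]
  rw [Finset.sum_congr rfl hterm]
  rcases Nat.lt_or_ge b n with h | h
  · rw [min_eq_right (by omega), min_eq_right (by omega), Finset.sum_range_succ, Nat.sub_self,
      pderiv_two_dividedMonomial_zero, neg_zero, add_zero]
  · rw [min_eq_left (by omega), min_eq_left (by omega)]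

/-- for `0 ≤ i ≤ a`, the pair (11) satisfies the Hermitean monogenicity
system `∂_{z₁}F₂ − ∂_{z₂}F₁ = 0` and `∂_{w₁}F₁ + ∂_{w₂}F₂ = 0`. -/
theorem PB_hermitean_monogenic (a b i : ℕ) (hi : i ≤ a) :
    pderiv (0 : Fin 4) (PB a b i).2 - pderiv (1 : Fin 4) (PB a b i).1 = 0 ∧
    pderiv (2 : Fin 4) (PB a b i).1 + pderiv (3 : Fin 4) (PB a b i).2 = 0 := by
  rw [pderiv_zero_PB_snd, pderiv_three_PB_snd]
  exact ⟨sub_self _, add_neg_cancel _⟩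

end
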